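/- Under the sector setup (see context), we have |C|·|C*| ≥ |[o,u,v,p]|·|[o,u*,v*]| = |[o,u,v]|·|[o,u*,v*,p*]|, with equality if and only if either C = [o,u,v] or C = [o,u,v,p]. -/

import Mathlib

open MeasureTheory Pointwise Real
open scoped RealInnerProductSpace

/-- Area (two-dimensional Lebesgue measure) of a subset of the plane `ℂ ≅ ℝ²`. -/
noncomputable def area (K : Set ℂ) : ℝ := (volume K).toReal

/-- The polar body `K* = {x : ⟨x,y⟩ ≤ 1 for all y ∈ K}`. -/
def polarBody (K : Set ℂ) : Set ℂ := {x | ∀ y ∈ K, ⟪x, y⟫ ≤ 1}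

/-- A convex body: a compact convex set with nonempty interior. -/
def IsConvexBody (K : Set ℂ) : Prop := Convex ℝ K ∧ IsCompact K ∧ (interior K).Nonempty

def cross (x y : ℂ) : ℝ := x.re * y.im - x.im * y.re

lemma mem_convexHull_zero_triple {E : Type*} [AddCommGroup E] [Module ℝ E] {u v w x : E} :
    x ∈ convexHull ℝ {0, u, v, w} ↔ ∃ α β γ : ℝ, 0 ≤ α ∧ 0 ≤ β ∧ 0 ≤ γ ∧ α + β + γ ≤ 1 ∧
      x = α • u + β • v + γ • w := by
  constructor
  · intro hx
    refine convexHull_min (s := {0, u, v, w}) (t := {x : E | ∃ α β γ : ℝ, 0 ≤ α ∧ 0 ≤ β ∧ 0 ≤ γ ∧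
      α + β + γ ≤ 1 ∧ x = α • u + β • v + γ • w}) ?_ ?_ hx
    · rintro y (rfl | rfl | rfl | rfl)
      · exact ⟨0, 0, 0, by simp⟩
      · exact ⟨1, 0, 0, by simp⟩
      · exact ⟨0, 1, 0, by simp⟩
      · exact ⟨0, 0, 1, by simp⟩
    · rintro y ⟨α, β, γ, h1, h2, h3, h4, rfl⟩ z ⟨α', β', γ', h1', h2', h3', h4', rfl⟩ s t hs ht hst
      refine ⟨s * α + t * α', s * β + t * β', s * γ + t * γ', by positivity, by positivity,
        by positivity, by nlinarith, by module⟩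
  · rintro ⟨α, β, γ, h1, h2, h3, h4, rfl⟩
    have hc := convex_convexHull ℝ ({0, u, v, w} : Set E)
    have h := hc.sum_mem (t := Finset.univ) (w := ![1 - α - β - γ, α, β, γ]) (z := ![0, u, v, w])
      (by intro i _; fin_cases i <;> simp <;> linarith)
      (by simp [Fin.sum_univ_four]; ring)
      (by intro i _; apply subset_convexHull; fin_cases i <;> simp)
    simpa [Fin.sum_univ_four] using h

lemma mem_convexHull_zero_pair {E : Type*} [AddCommGroup E] [Module ℝ E] {u v x : E} :
    x ∈ convexHull ℝ {0, u, v} ↔ ∃ α β : ℝ, 0 ≤ α ∧ 0 ≤ β ∧ α + β ≤ 1 ∧ x = α • u + β • v := by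
  have : ({0, u, v} : Set E) = {0, u, v, v} := by simp
  rw [this, mem_convexHull_zero_triple]
  constructor
  · rintro ⟨α, β, γ, h1, h2, h3, h4, rfl⟩
    exact ⟨α, β + γ, h1, by positivity, by linarith, by module⟩
  · rintro ⟨α, β, h1, h2, h3, rfl⟩
    exact ⟨α, β, 0, h1, h2, le_rfl, by linarith, by module⟩

lemma area_standard_triangle : area (convexHull ℝ {(0 : ℂ), 1, Complex.I}) = 1 / 2 := by
  have hset : convexHull ℝ {(0 : ℂ), 1, Complex.I} = Complex.measurableEquivRealProd ⁻¹'
      {q : ℝ × ℝ | 0 ≤ q.1 ∧ 0 ≤ q.2 ∧ q.1 + q.2 ≤ 1} := by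
    ext x
    rw [mem_convexHull_zero_pair]
    simp only [Set.mem_preimage, Set.mem_ofPred_eq, Complex.measurableEquivRealProd_apply]
    constructor
    · rintro ⟨α, β, h1, h2, h3, rfl⟩
      simp [h1, h2, h3]
    · rintro ⟨h1, h2, h3⟩
      exact ⟨x.re, x.im, h1, h2, h3, by apply Complex.ext <;> simp⟩
  have hm : MeasurableSet {q : ℝ × ℝ | 0 ≤ q.1 ∧ 0 ≤ q.2 ∧ q.1 + q.2 ≤ 1} := by
    refine IsClosed.measurableSet (IsClosed.and ?_ (IsClosed.and ?_ ?_)) <;>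
      exact isClosed_le (by fun_prop) (by fun_prop)
  rw [area, hset, Complex.volume_preserving_equiv_real_prod.measure_preimage hm.nullMeasurableSet,
    Measure.volume_eq_prod, Measure.prod_apply hm]
  have hslice : ∀ x : ℝ, volume (Prod.mk x ⁻¹' {q : ℝ × ℝ | 0 ≤ q.1 ∧ 0 ≤ q.2 ∧ q.1 + q.2 ≤ 1}) =
      (Set.Icc (0 : ℝ) 1).indicator (fun x => ENNReal.ofReal (1 - x)) x := by
    intro x
    by_cases hx : x ∈ Set.Icc (0 : ℝ) 1
    · have : Prod.mk x ⁻¹' {q : ℝ × ℝ | 0 ≤ q.1 ∧ 0 ≤ q.2 ∧ q.1 + q.2 ≤ 1} =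
          Set.Icc 0 (1 - x) := by
        ext y
        simp only [Set.mem_preimage, Set.mem_ofPred_eq, Set.mem_Icc]
        exact ⟨fun h => ⟨h.2.1, by linarith⟩, fun h => ⟨hx.1, h.1, by linarith⟩⟩
      rw [this, Set.indicator_of_mem hx, Real.volume_Icc, sub_zero]
    · have : Prod.mk x ⁻¹' {q : ℝ × ℝ | 0 ≤ q.1 ∧ 0 ≤ q.2 ∧ q.1 + q.2 ≤ 1} = ∅ := by
        ext y
        simp only [Set.mem_preimage, Set.mem_ofPred_eq, Set.mem_empty_iff_false, iff_false]
        exact fun h => hx ⟨h.1, by linarith⟩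
      rw [this, Set.indicator_of_notMem hx, measure_empty]
  simp_rw [hslice]
  rw [lintegral_indicator measurableSet_Icc, ← ofReal_integral_eq_lintegral_ofReal,
    integral_Icc_eq_integral_Ioc, ← intervalIntegral.integral_of_le zero_le_one]
  · have hval : ∫ x in (0 : ℝ)..1, (1 - x) = 1 / 2 := by
      rw [intervalIntegral.integral_sub (by simp) (by simp)]
      norm_num
    rw [hval, ENNReal.toReal_ofReal (by norm_num)]
  · exact (by fun_prop : Continuous fun x : ℝ => 1 - x).continuousOn.integrableOn_compact
      isCompact_Icc
  · filter_upwards [ae_restrict_mem measurableSet_Icc] with x hx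
    simpa using hx.2

lemma area_triangle (u v : ℂ) : area (convexHull ℝ {0, u, v}) = |cross u v| / 2 := by
  set L : ℂ →ₗ[ℝ] ℂ := Complex.basisOneI.constr ℝ ![u, v] with hL
  have h1 : L 1 = u := by
    rw [hL, show (1 : ℂ) = Complex.basisOneI 0 by simp, Module.Basis.constr_basis]
    rfl
  have h2 : L Complex.I = v := by
    rw [hL, show Complex.I = Complex.basisOneI 1 by simp, Module.Basis.constr_basis]
    rfl
  have hdet : LinearMap.det L = cross u v := by
    rw [← LinearMap.det_toMatrix Complex.basisOneI, Matrix.det_fin_two]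
    simp [LinearMap.toMatrix_apply, h1, h2, cross]
    ring
  have himg : convexHull ℝ {0, u, v} = L '' convexHull ℝ {0, 1, Complex.I} := by
    rw [LinearMap.image_convexHull]
    simp [Set.image_insert_eq, h1, h2]
  rw [area, himg, Measure.addHaar_image_linearMap, hdet, ENNReal.toReal_mul,
    ENNReal.toReal_ofReal (abs_nonneg _)]
  have := area_standard_triangle
  rw [area] at this
  rw [this]
  ring

lemma eq_zero_of_smul_add_smul_eq_zero {u v : ℂ} (h : cross u v ≠ 0) {α β : ℝ}
    (h0 : α • u + β • v = 0) : α = 0 ∧ β = 0 := by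
  have hre := congrArg Complex.re h0
  have him := congrArg Complex.im h0
  simp at hre him
  unfold cross at h
  constructor
  · refine (mul_eq_zero.1 (?_ : α * (u.re * v.im - u.im * v.re) = 0)).resolve_right h
    linear_combination v.im * hre - v.re * him
  · refine (mul_eq_zero.1 (?_ : β * (u.re * v.im - u.im * v.re) = 0)).resolve_right h
    linear_combination u.re * him - u.im * hre

lemma area_quadrilateral {u v : ℂ} (h : cross u v ≠ 0) {s t : ℝ} (hs : 0 ≤ s) (ht : 0 ≤ t)
    (hst : 1 ≤ s + t) :
    area (convexHull ℝ {0, u, v, s • u + t • v}) = |cross u v| * (s + t) / 2 := by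
  set c := s • u + t • v with hc
  have hunion : convexHull ℝ {0, u, v, c} = convexHull ℝ {0, u, c} ∪ convexHull ℝ {0, c, v} := by
    apply Set.Subset.antisymm
    · intro x hx
      obtain ⟨α, β, γ, hα, hβ, hγ, hsum, rfl⟩ := mem_convexHull_zero_triple.1 hx
      rcases le_total (β * s) (α * t) with hle | hle
      · left
        rw [mem_convexHull_zero_pair]
        rcases ht.eq_or_lt with rfl | htpos
        · have hβ0 : β = 0 := by nlinarith
          exact ⟨α, γ, hα, hγ, by linarith, by rw [hβ0]; module⟩
        · refine ⟨α - β * s / t, γ + β / t, ?_, by positivity, ?_, ?_⟩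
          · rw [sub_nonneg, div_le_iff₀ htpos]; exact hle
          · have : β * (1 - s) / t ≤ β := by rw [div_le_iff₀ htpos]; nlinarith
            have e : β * (1 - s) / t = β / t - β * s / t := by ring
            linarith
          · rw [hc]; match_scalars <;> field_simp <;> ring
      · right
        rw [mem_convexHull_zero_pair]
        rcases hs.eq_or_lt with rfl | hspos
        · have hα0 : α = 0 := by nlinarith
          exact ⟨γ, β, hγ, hβ, by linarith, by rw [hα0]; module⟩
        · refine ⟨γ + α / s, β - α * t / s, by positivity, ?_, ?_, ?_⟩
          · rw [sub_nonneg, div_le_iff₀ hspos]; exact hle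
          · have : α * (1 - t) / s ≤ α := by rw [div_le_iff₀ hspos]; nlinarith
            have e : α * (1 - t) / s = α / s - α * t / s := by ring
            linarith
          · rw [hc]; match_scalars <;> field_simp <;> ring
    · apply Set.union_subset <;> apply convexHull_mono <;> intro x hx <;>
        simp only [Set.mem_insert_iff, Set.mem_singleton_iff] at hx ⊢ <;> tauto
  have hinter : volume (convexHull ℝ {0, u, c} ∩ convexHull ℝ {0, c, v}) = 0 := by
    have hspan : (Submodule.span ℝ {c}) ≠ ⊤ := by
      intro htop
      have h1 := finrank_span_le_card (R := ℝ) ({c} : Set ℂ)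
      rw [htop, finrank_top, Complex.finrank_real_complex] at h1
      simp at h1
    refine measure_mono_null ?_ (Measure.addHaar_submodule volume _ hspan)
    rintro x ⟨h1, h2⟩
    obtain ⟨α, β, hα, hβ, -, rfl⟩ := mem_convexHull_zero_pair.1 h1
    obtain ⟨γ, δ, hγ, hδ, -, he⟩ := mem_convexHull_zero_pair.1 h2
    have := eq_zero_of_smul_add_smul_eq_zero h (α := α + (β - γ) * s) (β := (β - γ) * t - δ) (by
      rw [← sub_eq_zero] at he
      rw [← he, hc]; module)
    refine Submodule.mem_span_singleton.2 ?_
    rcases ht.eq_or_lt with rfl | htpos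
    · have hspos : 0 < s := by linarith
      exact ⟨α / s + β, by rw [hc, zero_smul, add_zero]; match_scalars; field_simp⟩
    · have hβγ : 0 ≤ β - γ := by
        by_contra hneg
        nlinarith
      have hα0 : α = 0 := by nlinarith [mul_nonneg hβγ hs]
      exact ⟨β, by rw [hα0]; module⟩
  have hcpt : IsCompact (convexHull ℝ {0, c, v}) :=
    (Set.toFinite _).isCompact_convexHull ℝ
  have hcpt' : IsCompact (convexHull ℝ {0, u, c}) :=
    (Set.toFinite _).isCompact_convexHull ℝ
  have hA := area_triangle u c
  have hB := area_triangle c v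
  rw [area] at hA hB
  have e1 : cross u c = t * cross u v := by simp [hc, cross]; ring
  have e2 : cross c v = s * cross u v := by simp [hc, cross]; ring
  rw [area, hunion, measure_union₀ hcpt.measurableSet.nullMeasurableSet hinter,
    ENNReal.toReal_add hcpt'.measure_lt_top.ne hcpt.measure_lt_top.ne, hA, hB, e1, e2,
    abs_mul, abs_mul, abs_of_nonneg hs, abs_of_nonneg ht]
  ring

lemma mem_quadrilateral {E : Type*} [AddCommGroup E] [Module ℝ E] {u v p : E} {a b α β : ℝ}
    (ha : a ≤ 1) (hb : b ≤ 1) (hab : a * b < 1)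
    (hp : p = ((1 - a) / (1 - a * b)) • u + ((1 - b) / (1 - a * b)) • v)
    (hα : 0 ≤ α) (hβ : 0 ≤ β) (h1 : α + a * β ≤ 1) (h2 : b * α + β ≤ 1) :
    α • u + β • v ∈ convexHull ℝ {0, u, v, p} := by
  have hd : 0 < 1 - a * b := by linarith
  have hd' : 1 - a * b ≠ 0 := hd.ne'
  rw [mem_convexHull_zero_triple]
  rcases le_total (β * (1 - a)) (α * (1 - b)) with hle | hle
  · rcases hb.eq_or_lt with rfl | hb
    · have : β = 0 := by nlinarith
      subst this
      exact ⟨α, 0, 0, hα, le_rfl, le_rfl, by linarith, by module⟩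
    · have hb' : 0 < 1 - b := by linarith
      refine ⟨α - β * (1 - a) / (1 - b), 0, β * (1 - a * b) / (1 - b), ?_, le_rfl, by positivity,
        ?_, ?_⟩
      · rw [sub_nonneg, div_le_iff₀ hb']; exact hle
      · have : α - β * (1 - a) / (1 - b) + 0 + β * (1 - a * b) / (1 - b) = α + a * β := by
          field_simp; ring
        linarith
      · rw [hp]; match_scalars <;> field_simp <;> ring
  · rcases ha.eq_or_lt with rfl | ha
    · have : α = 0 := by nlinarith
      subst this
      exact ⟨0, β, 0, le_rfl, hβ, le_rfl, by linarith, by module⟩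
    · have ha' : 0 < 1 - a := by linarith
      refine ⟨0, β - α * (1 - b) / (1 - a), α * (1 - a * b) / (1 - a), le_rfl, ?_, by positivity,
        ?_, ?_⟩
      · rw [sub_nonneg, div_le_iff₀ ha']; exact hle
      · have : 0 + (β - α * (1 - b) / (1 - a)) + α * (1 - a * b) / (1 - a) = b * α + β := by
          field_simp; ring
        linarith
      · have e1 : α * (1 - a * b) / (1 - a) * ((1 - a) / (1 - a * b)) = α := by field_simp
        have e2 : α * (1 - a * b) / (1 - a) * ((1 - b) / (1 - a * b)) = α * (1 - b) / (1 - a) := by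
          field_simp
        rw [hp, smul_add, smul_smul, smul_smul, e1, e2]
        module

/-- A convex set is determined by a closed subset of the same positive finite area. -/
lemma eq_of_subset_of_area_eq {A B : Set ℂ} (hA : IsClosed A) (hB : Convex ℝ B) (hsub : A ⊆ B)
    (hfin : volume B ≠ ⊤) (hpos : 0 < area A) (harea : area B = area A) : A = B := by
  have hfinA : volume A ≠ ⊤ := measure_ne_top_of_subset hsub hfin
  have hvol : volume B = volume A := (ENNReal.toReal_eq_toReal_iff' hfin hfinA).1 harea
  have hBpos : volume B ≠ 0 := by
    intro h0
    rw [← harea, area, h0] at hpos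
    simp at hpos
  have hint : (interior B).Nonempty := by
    by_contra hne
    rw [Set.not_nonempty_iff_eq_empty] at hne
    apply hBpos
    refine measure_mono_null ?_ (hB.addHaar_frontier volume)
    rw [frontier, hne, Set.sdiff_empty]
    exact subset_closure
  have hdiff : volume (interior B \ A) = 0 := by
    refine measure_mono_null (Set.sdiff_subset_sdiff_left interior_subset) ?_
    rw [measure_sdiff hsub hA.measurableSet.nullMeasurableSet hfinA, hvol, tsub_self]
  have hempty : interior B \ A = ∅ :=
    (isOpen_interior.sdiff hA).measure_eq_zero_iff volume |>.1 hdiff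
  refine hsub.antisymm (subset_closure.trans ?_)
  rw [← hB.closure_interior_eq_closure_of_nonempty_interior hint]
  exact closure_minimal (Set.sdiff_eq_empty.1 hempty) hA

lemma cross_ne_zero {x y : ℂ} (h : LinearIndependent ℝ ![x, y]) : cross x y ≠ 0 := by
  intro h0
  rw [cross] at h0
  rw [LinearIndependent.pair_iff] at h
  have h1 := h y.im (-x.im) (by apply Complex.ext <;> simp <;> linarith)
  have h2 := h y.re (-x.re) (by apply Complex.ext <;> simp <;> linarith)
  have hx : x = 0 := Complex.ext (by simpa using h2.2) (by simpa using h1.2)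
  have := h 1 0 (by simp [hx])
  simp at this

lemma exists_eq_smul_add_smul {u v : ℂ} (h : cross u v ≠ 0) (x : ℂ) :
    ∃ α β : ℝ, x = α • u + β • v := by
  refine ⟨cross x v / cross u v, cross u x / cross u v, ?_⟩
  have key : cross u v • x = cross x v • u + cross u x • v := by
    apply Complex.ext <;> simp [cross] <;> ring
  calc x = (cross u v)⁻¹ • (cross u v • x) := (inv_smul_smul₀ h x).symm
    _ = _ := by rw [key]; module

lemma cross_mul_cross (u v us vs : ℂ) :
    cross u v * cross us vs = ⟪us, u⟫ * ⟪vs, v⟫ - ⟪us, v⟫ * ⟪vs, u⟫ := by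
  simp [cross, Complex.inner]
  ring

lemma eq_smul_add_smul_of_inner_eq_one {u v us vs p : ℂ} (hcross : cross u v ≠ 0)
    (husu : ⟪us, u⟫ = 1) (hvsv : ⟪vs, v⟫ = 1) (hd : 1 - ⟪us, v⟫ * ⟪vs, u⟫ ≠ 0)
    (hp1 : ⟪us, p⟫ = 1) (hp2 : ⟪vs, p⟫ = 1) :
    p = ((1 - ⟪us, v⟫) / (1 - ⟪us, v⟫ * ⟪vs, u⟫)) • u +
      ((1 - ⟪vs, u⟫) / (1 - ⟪us, v⟫ * ⟪vs, u⟫)) • v := by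
  obtain ⟨α, β, rfl⟩ := exists_eq_smul_add_smul hcross p
  simp only [inner_add_right, real_inner_smul_right, husu, hvsv] at hp1 hp2
  congr 2
  · rw [eq_div_iff hd]
    linear_combination hp1 - ⟪us, v⟫ * hp2
  · rw [eq_div_iff hd]
    linear_combination hp2 - ⟪vs, u⟫ * hp1

lemma convex_polarBody (K : Set ℂ) : Convex ℝ (polarBody K) := by
  intro x hx y hy s t hs ht hst k hk
  rw [inner_add_left, real_inner_smul_left, real_inner_smul_left]
  nlinarith [hx k hk, hy k hk]

lemma one_sub_mul_pos {u v us vs p : ℂ} (hcross : cross u v ≠ 0) (hcross' : cross us vs ≠ 0)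
    (husu : ⟪us, u⟫ = 1) (hvsv : ⟪vs, v⟫ = 1) (ha : ⟪us, v⟫ ≤ 1) (hb : ⟪vs, u⟫ ≤ 1)
    (hp1 : ⟪us, p⟫ = 1) (hp2 : ⟪vs, p⟫ = 1)
    (hpseg : (segment ℝ p 0 ∩ segment ℝ u v).Nonempty) :
    0 < 1 - ⟪us, v⟫ * ⟪vs, u⟫ := by
  have hne : 1 - ⟪us, v⟫ * ⟪vs, u⟫ ≠ 0 := by
    have := cross_mul_cross u v us vs
    rw [husu, hvsv, one_mul] at this
    rw [← this]
    exact mul_ne_zero hcross hcross'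
  obtain ⟨w, ⟨c, c', hc, hc', hcc, rfl⟩, ⟨d, d', hd, hd', hdd, he⟩⟩ := hpseg
  obtain ⟨α, β, rfl⟩ := exists_eq_smul_add_smul hcross p
  simp only [inner_add_right, real_inner_smul_right, husu, hvsv] at hp1 hp2
  have := eq_zero_of_smul_add_smul_eq_zero hcross (α := d - c * α) (β := d' - c * β) (by
    rw [← sub_eq_zero] at he
    rw [← he]; module)
  have h1 : c * (α + β) = 1 := by linarith
  have hαβ : 0 < α + β := by
    by_contra hneg
    nlinarith
  have h2 : (α + β) * (1 - ⟪us, v⟫ * ⟪vs, u⟫) = (1 - ⟪us, v⟫) + (1 - ⟪vs, u⟫) := by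
    linear_combination (1 - ⟪vs, u⟫) * hp1 + (1 - ⟪us, v⟫) * hp2
  refine lt_of_le_of_ne ?_ hne.symm
  by_contra hneg
  nlinarith

/-- If the polar sector is a quadrilateral with apex `⟪ps, z⟫⁻¹ • ps`, then an apex `z` of the
sector beyond the chord `[u, v]` lies on the supporting line at `u`. -/
lemma one_le_inner_of_polar_subset {K : Set ℂ} {u v us vs ps z : ℂ}
    (hkey : ∀ k ∈ K, k ∈ convexHull ℝ {0, u, v, z} ∨ ⟪ps, k⟫ ≤ 1)
    (husK : us ∈ polarBody K) (husu : ⟪us, u⟫ = 1) (ha : ⟪us, v⟫ < 1) (hb : ⟪vs, u⟫ < 1)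
    (hpsu : ⟪ps, u⟫ = 1) (hpsv : ⟪ps, v⟫ = 1) (hz : 1 < ⟪ps, z⟫)
    (hsub : polarBody K ∩ convexHull ℝ {0, us, vs, ps} ⊆
      convexHull ℝ {0, us, vs, ⟪ps, z⟫⁻¹ • ps}) :
    1 ≤ ⟪us, z⟫ := by
  by_contra! hlt
  set M := ⟪ps, z⟫ with hM
  set c := ⟪us, z⟫ with hc
  have hMc : 0 < M - c := by linarith
  set ε := (1 - c) / (M - c) with hε
  have hε0 : 0 < ε := div_pos (by linarith) hMc
  have hε1 : ε < 1 := by rw [hε, div_lt_one hMc]; linarith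
  have hεM : (1 - ε) * c + ε * M = 1 := by rw [hε]; field_simp; ring
  have hyK : (1 - ε) • us + ε • ps ∈ polarBody K := by
    intro k hk
    have husk : ⟪us, k⟫ ≤ 1 := husK k hk
    rw [inner_add_left, real_inner_smul_left, real_inner_smul_left]
    rcases hkey k hk with hkC | hk1
    · obtain ⟨α, β, γ, hα, hβ, hγ, hsum, rfl⟩ := mem_convexHull_zero_triple.1 hkC
      simp only [inner_add_right, real_inner_smul_right, husu, hpsu, hpsv, ← hM, ← hc]
      have e : (1 - ε) * (α * 1 + β * ⟪us, v⟫ + γ * c) + ε * (α * 1 + β * 1 + γ * M) =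
          α + β * ((1 - ε) * ⟪us, v⟫ + ε) + γ := by linear_combination γ * hεM
      rw [e]
      nlinarith [mul_nonneg hβ (mul_nonneg (sub_nonneg.2 hε1.le) (sub_nonneg.2 ha.le))]
    · nlinarith
  have hyhull : (1 - ε) • us + ε • ps ∈ convexHull ℝ {0, us, vs, ps} :=
    mem_convexHull_zero_triple.2 ⟨1 - ε, 0, ε, by linarith, le_rfl, hε0.le, by linarith, by module⟩
  obtain ⟨α, β, γ, hα, hβ, hγ, hsum, he⟩ := mem_convexHull_zero_triple.1 (hsub ⟨hyK, hyhull⟩)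
  have hu := congrArg (fun x => ⟪x, u⟫) he
  have hv := congrArg (fun x => ⟪x, v⟫) he
  simp only [inner_add_left, real_inner_smul_left, husu, hpsu, hpsv] at hu hv
  have hMinv : M⁻¹ < 1 := inv_lt_one_of_one_lt₀ hz
  have h1 : 0 ≤ β * (1 - ⟪vs, u⟫) := mul_nonneg hβ (by linarith)
  have h2 : 0 ≤ γ * (1 - M⁻¹) := mul_nonneg hγ (by linarith)
  have h3 : β * (1 - ⟪vs, u⟫) = 0 := by linarith
  have h4 : γ * (1 - M⁻¹) = 0 := by linarith
  have hβ0 : β = 0 := (mul_eq_zero.1 h3).resolve_right (by linarith)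
  have hγ0 : γ = 0 := (mul_eq_zero.1 h4).resolve_right (by linarith)
  subst hβ0 hγ0
  have hα1 : α = 1 := by linarith
  subst hα1
  nlinarith

set_option maxHeartbeats 1000000 in
/-- The sector lemma: under the sector setup,
`|C|·|C*| ≥ |[o,u,v,p]|·|[o,u*,v*]| = |[o,u,v]|·|[o,u*,v*,p*]|`,
with equality iff `C = [o,u,v]` or `C = [o,u,v,p]`. -/
theorem sector_lemma (K : Set ℂ) (hK : IsConvexBody K) (ho : (0 : ℂ) ∈ interior K)
    (u v us vs p ps : ℂ)
    (huv : LinearIndependent ℝ ![u, v])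
    (hu : u ∈ frontier K) (hv : v ∈ frontier K)
    (husvs : LinearIndependent ℝ ![us, vs])
    (hus : us ∈ frontier (polarBody K)) (hvs : vs ∈ frontier (polarBody K))
    (husu : ⟪us, u⟫ = 1) (hvsv : ⟪vs, v⟫ = 1)
    (hsupp : ∀ y ∈ K, ⟪us, y⟫ ≤ 1 ∧ ⟪vs, y⟫ ≤ 1)
    (hp : ⟪us, p⟫ = 1 ∧ ⟪vs, p⟫ = 1)
    (hpseg : (segment ℝ p 0 ∩ segment ℝ u v).Nonempty)
    (hps : ⟪ps, u⟫ = 1 ∧ ⟪ps, v⟫ = 1)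
    (hpsseg : (segment ℝ ps 0 ∩ segment ℝ us vs).Nonempty)
    (C Cs : Set ℂ)
    (hC : C = K ∩ convexHull ℝ {0, u, v, p})
    (hCs : Cs = polarBody K ∩ convexHull ℝ {0, us, vs, ps}) :
    area (convexHull ℝ {0, u, v, p}) * area (convexHull ℝ {(0 : ℂ), us, vs}) =
        area (convexHull ℝ {(0 : ℂ), u, v}) * area (convexHull ℝ {0, us, vs, ps}) ∧
    area (convexHull ℝ {0, u, v, p}) * area (convexHull ℝ {(0 : ℂ), us, vs}) ≤
        area C * area Cs ∧
    (area C * area Cs =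
        area (convexHull ℝ {0, u, v, p}) * area (convexHull ℝ {(0 : ℂ), us, vs}) ↔
      C = convexHull ℝ {(0 : ℂ), u, v} ∨ C = convexHull ℝ {0, u, v, p}) := by
  set a := ⟪us, v⟫ with ha_def
  set b := ⟪vs, u⟫ with hb_def
  have hKclosed : IsClosed K := hK.2.1.isClosed
  have huK : u ∈ K := hKclosed.frontier_subset hu
  have hvK : v ∈ K := hKclosed.frontier_subset hv
  have h0K : (0 : ℂ) ∈ K := interior_subset ho
  have husK : us ∈ polarBody K := fun y hy => (hsupp y hy).1
  have hvsK : vs ∈ polarBody K := fun y hy => (hsupp y hy).2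
  have h0Ks : (0 : ℂ) ∈ polarBody K := fun y _ => by simp
  have ha : a ≤ 1 := (hsupp v hvK).1
  have hb : b ≤ 1 := (hsupp u huK).2
  have hcross := cross_ne_zero huv
  have hcross' := cross_ne_zero husvs
  have hd : 0 < 1 - a * b :=
    one_sub_mul_pos hcross hcross' husu hvsv ha hb hp.1 hp.2 hpseg
  have hprod : |cross u v| * |cross us vs| = 1 - a * b := by
    rw [← abs_mul, cross_mul_cross, husu, hvsv, one_mul, abs_of_pos hd]
  have hpeq := eq_smul_add_smul_of_inner_eq_one hcross husu hvsv hd.ne' hp.1 hp.2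
  have hpseq : ps = ((1 - b) / (1 - a * b)) • us + ((1 - a) / (1 - a * b)) • vs := by
    have := eq_smul_add_smul_of_inner_eq_one (us := u) (vs := v) hcross'
      (by rw [real_inner_comm]; exact husu) (by rw [real_inner_comm]; exact hvsv)
      (by rw [real_inner_comm, real_inner_comm us v, mul_comm]; exact hd.ne')
      (by rw [real_inner_comm]; exact hps.1) (by rw [real_inner_comm]; exact hps.2)
    rwa [real_inner_comm vs u, real_inner_comm us v, mul_comm] at this
  rw [← ha_def, ← hb_def] at hpeq
  have hs0 : 0 ≤ (1 - a) / (1 - a * b) := div_nonneg (by linarith) hd.le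
  have ht0 : 0 ≤ (1 - b) / (1 - a * b) := div_nonneg (by linarith) hd.le
  set s := (1 - a) / (1 - a * b) with hs_def
  set t := (1 - b) / (1 - a * b) with ht_def
  have hst : 1 ≤ s + t := by
    rw [hs_def, ht_def, ← add_div, le_div_iff₀ hd]
    nlinarith [mul_nonneg (sub_nonneg.2 ha) (sub_nonneg.2 hb)]
  have hD : 0 < |cross u v| := abs_pos.2 hcross
  have hDs : 0 < |cross us vs| := abs_pos.2 hcross'
  have hpsp : ⟪ps, p⟫ = s + t := by
    rw [hpeq, inner_add_right, real_inner_smul_right, real_inner_smul_right, hps.1, hps.2]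
    ring
  have areaQ : area (convexHull ℝ {0, u, v, p}) = |cross u v| * (s + t) / 2 := by
    rw [hpeq]; exact area_quadrilateral hcross hs0 ht0 hst
  have areaQs : area (convexHull ℝ {0, us, vs, ps}) = |cross us vs| * (s + t) / 2 := by
    rw [hpseq, area_quadrilateral hcross' ht0 hs0 (by linarith)]
    ring
  have areaT := area_triangle u v
  have areaTs := area_triangle us vs
  have hfst : area (convexHull ℝ {0, u, v, p}) * area (convexHull ℝ {(0 : ℂ), us, vs}) =
      area (convexHull ℝ {(0 : ℂ), u, v}) * area (convexHull ℝ {0, us, vs, ps}) := by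
    rw [areaQ, areaQs, areaT, areaTs]
    ring
  refine ⟨hfst, ?_⟩
  have hull_cpt : ∀ x y z : ℂ, IsCompact (convexHull ℝ {0, x, y, z}) := fun x y z =>
    (Set.toFinite _).isCompact_convexHull ℝ
  have hCconv : Convex ℝ C := hC ▸ hK.1.inter (convex_convexHull ℝ _)
  have hCsconv : Convex ℝ Cs := hCs ▸ (convex_polarBody K).inter (convex_convexHull ℝ _)
  have hCcpt : IsCompact C := hC ▸ hK.2.1.inter (hull_cpt u v p)
  have hCfin : volume C ≠ ⊤ := hCcpt.measure_lt_top.ne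
  have hCsfin : volume Cs ≠ ⊤ :=
    measure_ne_top_of_subset (hCs ▸ Set.inter_subset_right) (hull_cpt us vs ps).measure_lt_top.ne
  have hCK : C ⊆ K := hC ▸ Set.inter_subset_left
  have hCQ : C ⊆ convexHull ℝ {0, u, v, p} := hC ▸ Set.inter_subset_right
  have h0C : 0 ∈ C := hC ▸ ⟨h0K, subset_convexHull _ _ (by simp)⟩
  have huC : u ∈ C := hC ▸ ⟨huK, subset_convexHull _ _ (by simp)⟩
  have hvC : v ∈ C := hC ▸ ⟨hvK, subset_convexHull _ _ (by simp)⟩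
  have h0Cs : 0 ∈ Cs := hCs ▸ ⟨h0Ks, subset_convexHull _ _ (by simp)⟩
  have husCs : us ∈ Cs := hCs ▸ ⟨husK, subset_convexHull _ _ (by simp)⟩
  have hvsCs : vs ∈ Cs := hCs ▸ ⟨hvsK, subset_convexHull _ _ (by simp)⟩
  -- every point of `C` has nonnegative coordinates
  have hCcoord : ∀ x ∈ C, ∃ α β : ℝ, 0 ≤ α ∧ 0 ≤ β ∧ ⟪ps, x⟫ = α + β ∧ ⟪ps, x⟫ ≤ s + t ∧
      x = α • u + β • v := by
    intro x hx
    obtain ⟨α, β, γ, hα, hβ, hγ, hsum, rfl⟩ := mem_convexHull_zero_triple.1 (hCQ hx)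
    refine ⟨α + γ * s, β + γ * t, by positivity, by positivity, ?_, ?_, ?_⟩
    · simp only [inner_add_right, real_inner_smul_right, hps.1, hps.2, hpsp]
      ring
    · simp only [inner_add_right, real_inner_smul_right, hps.1, hps.2, hpsp]
      nlinarith
    · rw [hpeq]; module
  -- points of `K` outside the sector lie below the line dual to `ps`
  have hkey : ∀ k ∈ K, k ∈ C ∨ ⟪ps, k⟫ ≤ 1 := by
    intro k hk
    have hk1 := (hsupp k hk).1
    have hk2 := (hsupp k hk).2
    obtain ⟨α, β, rfl⟩ := exists_eq_smul_add_smul hcross k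
    simp only [inner_add_right, real_inner_smul_right, husu, hvsv, hps.1, hps.2,
      ← ha_def, ← hb_def] at hk1 hk2 ⊢
    rcases lt_or_ge α 0 with hα | hα
    · right; nlinarith
    rcases lt_or_ge β 0 with hβ | hβ
    · right; nlinarith
    left
    rw [hC]
    exact ⟨hk, mem_quadrilateral ha hb (by linarith) hpeq hα hβ (by linarith) (by linarith)⟩
  obtain ⟨z, hzC, hzmax⟩ := hCcpt.exists_isMaxOn ⟨u, huC⟩
    (f := fun x => ⟪ps, x⟫) (by fun_prop)
  have hzmax' : ∀ x ∈ C, ⟪ps, x⟫ ≤ ⟪ps, z⟫ := fun x hx => hzmax hx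
  obtain ⟨z₁, z₂, hz₁, hz₂, hzsum, hzle, hzeq⟩ := hCcoord z hzC
  have hM1 : 1 ≤ ⟪ps, z⟫ := hps.1 ▸ hzmax' u huC
  set M := ⟪ps, z⟫ with hM_def
  have hM0 : 0 < M := by linarith
  set w := M⁻¹ • ps with hw_def
  have hMinv : M⁻¹ ≤ 1 := inv_le_one_of_one_le₀ hM1
  have hwCs : w ∈ Cs := by
    rw [hCs]
    refine ⟨fun k hk => ?_, mem_convexHull_zero_triple.2
      ⟨0, 0, M⁻¹, le_rfl, le_rfl, by positivity, by linarith, by rw [hw_def]; module⟩⟩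
    rw [hw_def, real_inner_smul_left, inv_mul_le_iff₀ hM0, mul_one]
    rcases hkey k hk with h | h
    · exact hzmax' k h
    · linarith
  have hsubC : convexHull ℝ {0, u, v, z} ⊆ C := by
    refine convexHull_min ?_ hCconv
    rintro x (rfl | rfl | rfl | rfl) <;> assumption
  have hsubCs : convexHull ℝ {0, us, vs, w} ⊆ Cs := by
    refine convexHull_min ?_ hCsconv
    rintro x (rfl | rfl | rfl | hx)
    · assumption
    · assumption
    · assumption
    · rw [Set.mem_singleton_iff.1 hx]; exact hwCs
  have areaZ : area (convexHull ℝ {0, u, v, z}) = |cross u v| * M / 2 := by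
    rw [hzeq, area_quadrilateral hcross hz₁ hz₂ (by linarith), hzsum]
  have hweq : w = (t / M) • us + (s / M) • vs := by
    rw [hw_def, hpseq]; module
  have areaW : area (convexHull ℝ {0, us, vs, w}) = |cross us vs| * ((s + t) / M) / 2 := by
    rw [hweq, area_quadrilateral hcross' (by positivity) (by positivity)]
    · ring
    · rw [← add_div, le_div_iff₀ hM0]; linarith
  have hleC : |cross u v| * M / 2 ≤ area C := by
    rw [← areaZ]
    exact ENNReal.toReal_mono hCfin (measure_mono hsubC)
  have hleCs : |cross us vs| * ((s + t) / M) / 2 ≤ area Cs := by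
    rw [← areaW]
    exact ENNReal.toReal_mono hCsfin (measure_mono hsubCs)
  have hposC : 0 < |cross u v| * M / 2 := by positivity
  have hposCs : 0 < |cross us vs| * ((s + t) / M) / 2 := by
    have : 0 < s + t := by linarith
    positivity
  have hbound : area (convexHull ℝ {0, u, v, p}) * area (convexHull ℝ {(0 : ℂ), us, vs}) =
      |cross u v| * M / 2 * (|cross us vs| * ((s + t) / M) / 2) := by
    rw [areaQ, areaTs]
    field_simp
  refine ⟨hbound ▸ mul_le_mul hleC hleCs hposCs.le (hposC.le.trans hleC), ?_, ?_⟩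
  · intro heq
    rw [hbound] at heq
    obtain ⟨hCarea, hCsarea⟩ := (mul_eq_mul_iff_eq_and_eq_of_pos hleC hleCs hposC
      (hposCs.trans_le hleCs)).1 heq.symm
    have hCeq : convexHull ℝ {0, u, v, z} = C :=
      eq_of_subset_of_area_eq (hull_cpt u v z).isClosed hCconv hsubC hCfin
        (by rw [areaZ]; exact hposC) (by rw [areaZ, hCarea])
    have hCseq : convexHull ℝ {0, us, vs, w} = Cs :=
      eq_of_subset_of_area_eq (hull_cpt us vs w).isClosed hCsconv hsubCs hCsfin
        (by rw [areaW]; exact hposCs) (by rw [areaW, hCsarea])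
    rcases hM1.eq_or_lt with hM | hM
    · left
      apply Set.Subset.antisymm
      · intro x hx
        obtain ⟨α, β, hα, hβ, hsum, -, hxeq⟩ := hCcoord x hx
        exact mem_convexHull_zero_pair.2 ⟨α, β, hα, hβ, by linarith [hzmax' x hx], hxeq⟩
      · refine convexHull_min ?_ hCconv
        rintro x (rfl | rfl | rfl) <;> assumption
    · right
      have ha' : a < 1 := by
        refine lt_of_le_of_ne ha fun h => ?_
        have hd1 : 0 < 1 - b := by rw [h] at hd; linarith
        have : s + t = 1 := by rw [hs_def, ht_def, h]; field_simp; ring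
        linarith
      have hb' : b < 1 := by
        refine lt_of_le_of_ne hb fun h => ?_
        have hd1 : 0 < 1 - a := by rw [h] at hd; linarith
        have : s + t = 1 := by rw [hs_def, ht_def, h]; field_simp; ring
        linarith
      have h1 : 1 ≤ ⟪us, z⟫ := one_le_inner_of_polar_subset (hCeq ▸ hkey) husK husu ha' hb'
        hps.1 hps.2 hM (hCs ▸ hCseq ▸ subset_rfl)
      have h2 : 1 ≤ ⟪vs, z⟫ := by
        refine one_le_inner_of_polar_subset (K := K) (u := v) (v := u) (us := vs) (vs := us)
          (ps := ps) ?_ hvsK hvsv hb' ha' hps.2 hps.1 hM ?_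
        · rw [Set.insert_comm v u, hCeq]
          exact hkey
        · rw [Set.insert_comm vs us, Set.insert_comm vs us, ← hCs, ← hM_def, ← hw_def, hCseq]
      have hzp : z = p := by
        rw [eq_smul_add_smul_of_inner_eq_one hcross husu hvsv hd.ne'
          (le_antisymm (hsupp z (hCK hzC)).1 h1) (le_antisymm (hsupp z (hCK hzC)).2 h2)]
        exact hpeq.symm
      rw [← hCeq, hzp]
  · rintro (hCT | hCeq)
    · have hpsK : ps ∈ polarBody K := by
        intro k hk
        rcases hkey k hk with h | h
        · rw [hCT] at h
          obtain ⟨α, β, hα, hβ, hsum, rfl⟩ := mem_convexHull_zero_pair.1 h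
          simp only [inner_add_right, real_inner_smul_right, hps.1, hps.2]
          linarith
        · exact h
      have hCsQ : Cs = convexHull ℝ {0, us, vs, ps} := by
        rw [hCs]
        refine Set.inter_eq_right.2 (convexHull_min ?_ (convex_polarBody K))
        rintro x (rfl | rfl | rfl | rfl) <;> assumption
      rw [hfst, ← hCT, hCsQ]
    · have hpK : p ∈ K := hCK (hCeq ▸ subset_convexHull _ _ (by simp))
      have hCsT : Cs = convexHull ℝ {(0 : ℂ), us, vs} := by
        apply Set.Subset.antisymm
        · intro y hy
          rw [hCs] at hy
          obtain ⟨α, β, γ, hα, hβ, hγ, hsum, rfl⟩ := mem_convexHull_zero_triple.1 hy.2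
          have hyp := hy.1 p hpK
          simp only [inner_add_left, real_inner_smul_left, hp.1, hp.2, hpsp] at hyp
          refine mem_convexHull_zero_pair.2
            ⟨α + γ * t, β + γ * s, by positivity, by positivity, by linarith, ?_⟩
          rw [hpseq]; module
        · refine convexHull_min ?_ hCsconv
          rintro x (rfl | rfl | rfl) <;> assumption
      rw [← hCeq, hCsT]
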